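/- Let (R,m,k) be a commutative Noetherian local ring and let M and N be finitely generated R-modules. If t ≥ 0 is an integer such that Tor_t^R(M, mN) = 0 and Tor_{t+1}^R(M, mN) = 0, then either the projective dimension of M is at most t, or mN = 0. -/

import Mathlib

open CategoryTheory

universe u

/-- The colon submodule `(N :_X I) = {x ∈ X : I • x ⊆ N}`. -/
def Submodule.colonBy {R X : Type u} [CommRing R] [AddCommGroup X] [Module R X]
    (N : Submodule R X) (I : Ideal R) : Submodule R X where
  carrier := {x | ∀ r ∈ I, r • x ∈ N}
  add_mem' := by
    intro a b ha hb r hr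
    rw [smul_add]
    exact N.add_mem (ha r hr) (hb r hr)
  zero_mem' := by
    intro r hr
    rw [smul_zero]
    exact N.zero_mem
  smul_mem' := by
    intro c x hx r hr
    rw [smul_comm]
    exact N.smul_mem c (hx r hr)

/-- A submodule `N` of a module `X` over a local ring `(R, 𝔪)` is *Burch* if
`𝔪 • (N :_X 𝔪) ≠ 𝔪 • N`. -/
def Submodule.IsBurch {R X : Type u} [CommRing R] [IsLocalRing R] [AddCommGroup X]
    [Module R X] (N : Submodule R X) : Prop :=
  IsLocalRing.maximalIdeal R • N.colonBy (IsLocalRing.maximalIdeal R) ≠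
    IsLocalRing.maximalIdeal R • N

/-- `Tor_n^R(M, N) = 0`. -/
def TorIsZero (R : Type u) [CommRing R] (M N : Type u) [AddCommGroup M] [Module R M]
    [AddCommGroup N] [Module R N] (n : ℕ) : Prop :=
  Subsingleton (((Tor (ModuleCat.{u} R) n).obj (ModuleCat.of R M)).obj (ModuleCat.of R N))

/-- `Ext^n_R(M, N) = 0`. -/
def ExtIsZero (R : Type u) [CommRing R] (M N : Type u) [AddCommGroup M] [Module R M]
    [AddCommGroup N] [Module R N] (n : ℕ) : Prop :=
  Subsingleton
    (((Ext R (ModuleCat.{u} R) n).obj (Opposite.op (ModuleCat.of R M))).obj (ModuleCat.of R N))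

/-- `M` has projective dimension strictly less than `t`, i.e. `M` admits a projective
resolution vanishing in all degrees `≥ t`. -/
def HasProjDimLT (R : Type u) [CommRing R] (M : Type u) [AddCommGroup M] [Module R M]
    (t : ℕ) : Prop :=
  ∃ P : ProjectiveResolution (ModuleCat.of R M), ∀ i, t ≤ i → Limits.IsZero (P.complex.X i)

/-- `M` has injective dimension strictly less than `t`, i.e. `M` admits an injective
resolution vanishing in all degrees `≥ t`. -/
def HasInjDimLT (R : Type u) [CommRing R] (M : Type u) [AddCommGroup M] [Module R M]
    (t : ℕ) : Prop :=
  ∃ I : InjectiveResolution (ModuleCat.of R M), ∀ i, t ≤ i → Limits.IsZero (I.cocomplex.X i)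

/-- The depth of a module `M` over a local ring `(R, 𝔪, k)`: the smallest `i` such that
`Ext^i_R(k, M) ≠ 0` (and `⊤` if no such `i` exists). -/
noncomputable def moduleDepth (R : Type u) [CommRing R] [IsLocalRing R] (M : Type u)
    [AddCommGroup M] [Module R M] : ℕ∞ :=
  sInf {n : ℕ∞ | ∃ i : ℕ, n = (i : ℕ∞) ∧ ¬ ExtIsZero R (IsLocalRing.ResidueField R) M i}

open TensorProduct

theorem LinearMap.lTensor_rTensor_apply {R A B G H : Type*} [CommRing R]
    [AddCommGroup A] [Module R A] [AddCommGroup B] [Module R B]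
    [AddCommGroup G] [Module R G] [AddCommGroup H] [Module R H]
    (f : A →ₗ[R] B) (g : G →ₗ[R] H) (z : A ⊗[R] G) :
    g.lTensor B (f.rTensor G z) = f.rTensor H (g.lTensor A z) := by
  rw [← LinearMap.comp_apply, ← LinearMap.comp_apply, LinearMap.lTensor_comp_rTensor,
    LinearMap.rTensor_comp_lTensor]

theorem IsLocalRing.subsingleton_or_subsingleton_of_tensorProduct
    {R K L : Type*} [CommRing R] [IsLocalRing R]
    [AddCommGroup K] [Module R K] [Module.Finite R K]
    [AddCommGroup L] [Module R L] [Module.Finite R L]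
    (h : Subsingleton (K ⊗[R] L)) : Subsingleton K ∨ Subsingleton L := by
  rw [← subsingleton_tensorProduct (R := R) (M := K),
    ← subsingleton_tensorProduct (R := R) (M := L)]
  by_contra! hn
  obtain ⟨h₁, h₂⟩ := hn
  have := (TensorProduct.AlgebraTensorModule.distribBaseChange R (ResidueField R)
    K L).symm.injective.subsingleton
  exact not_subsingleton ((ResidueField R ⊗[R] K) ⊗[ResidueField R] (ResidueField R ⊗[R] L)) this

theorem IsLocalRing.subsingleton_of_top_le_smul_top {R X : Type*} [CommRing R] [IsLocalRing R]
    [AddCommGroup X] [Module R X] [Module.Finite R X]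
    (h : (⊤ : Submodule R X) ≤ maximalIdeal R • ⊤) : Subsingleton X := by
  rw [← Submodule.subsingleton_iff R]
  exact subsingleton_of_bot_eq_top (Submodule.eq_bot_of_le_smul_of_le_jacobson_bot _ _
    Module.Finite.fg_top h (maximalIdeal_le_jacobson _)).symm

theorem IsLocalRing.exists_surjective_ker_le_smul_top
    {R : Type u} [CommRing R] [IsLocalRing R]
    (M : Type u) [AddCommGroup M] [Module R M] [Module.Finite R M] :
    ∃ (n : ℕ) (p : (Fin n → R) →ₗ[R] M), Function.Surjective p ∧
      LinearMap.ker p ≤ maximalIdeal R • ⊤ := by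
  let b := Module.finBasis (ResidueField R) (ResidueField R ⊗[R] M)
  have hmk := TensorProduct.mk_surjective R M (ResidueField R) Ideal.Quotient.mk_surjective
  choose f hf using fun i ↦ hmk (b i)
  refine ⟨_, Fintype.linearCombination R f, ?_, fun c hc ↦ ?_⟩
  · rw [← LinearMap.range_eq_top, Fintype.range_linearCombination]
    exact span_eq_top_of_tmul_eq_basis f b hf
  · have h0 : ∑ i, residue R (c i) • b i = 0 := by
      have := congrArg (TensorProduct.mk R (ResidueField R) M 1) (LinearMap.mem_ker.1 hc)
      rw [Fintype.linearCombination_apply, map_sum, map_zero] at this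
      rw [← this]
      refine Finset.sum_congr rfl fun i _ ↦ ?_
      rw [map_smul, hf]
      exact algebraMap_smul (ResidueField R) (c i) (b i)
    have hc' := Fintype.linearIndependent_iff.1 b.linearIndependent _ h0
    rw [pi_eq_sum_univ c]
    refine Submodule.sum_mem _ fun i _ ↦ Submodule.smul_mem_smul ?_ trivial
    exact (residue_eq_zero_iff _).1 (hc' i)

/-- If `F` is flat, exactness of `M ⊗ G₃ → M ⊗ G₂ → M ⊗ G₁` and of `G₂ → G₁ → G₀` passes to
the kernel `K` of a surjection `F → M`, in one degree lower. -/
theorem exists_lTensor_eq_of_exact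
    {R K F M G₀ G₁ G₂ G₃ : Type*} [CommRing R]
    [AddCommGroup K] [Module R K] [AddCommGroup F] [Module R F] [AddCommGroup M] [Module R M]
    [AddCommGroup G₀] [Module R G₀] [AddCommGroup G₁] [Module R G₁]
    [AddCommGroup G₂] [Module R G₂] [AddCommGroup G₃] [Module R G₃]
    [Module.Flat R F] [Module.Flat R G₁]
    {i : K →ₗ[R] F} {p : F →ₗ[R] M} (hi : Function.Injective i) (hip : Function.Exact i p)
    (hp : Function.Surjective p)
    {d₃ : G₃ →ₗ[R] G₂} {d₂ : G₂ →ₗ[R] G₁} {d₁ : G₁ →ₗ[R] G₀}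
    (hd₃ : d₂ ∘ₗ d₃ = 0)
    (hF : Function.Exact (d₂.lTensor F) (d₁.lTensor F))
    (hM : Function.Exact (d₃.lTensor M) (d₂.lTensor M))
    (x : K ⊗[R] G₁) (hx : d₁.lTensor F (i.rTensor G₁ x) = 0) :
    ∃ y, d₂.lTensor K y = x := by
  obtain ⟨y, hy⟩ := (hF _).1 hx
  have h1 : d₂.lTensor M (p.rTensor G₂ y) = 0 := by
    rw [LinearMap.lTensor_rTensor_apply, hy]
    exact (rTensor_exact G₁ hip hp).apply_apply_eq_zero x
  obtain ⟨z, hz⟩ := (hM _).1 h1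
  obtain ⟨w, rfl⟩ := p.rTensor_surjective G₃ hp z
  have h2 : p.rTensor G₂ (y - d₃.lTensor F w) = 0 := by
    rw [map_sub, ← LinearMap.lTensor_rTensor_apply, hz, sub_self]
  obtain ⟨v, hv⟩ := (rTensor_exact G₂ hip hp _).1 h2
  refine ⟨v, Module.Flat.rTensor_preserves_injective_linearMap i hi ?_⟩
  rw [← LinearMap.lTensor_rTensor_apply, hv, map_sub, hy, ← LinearMap.comp_apply, ← LinearMap.lTensor_comp, hd₃]
  simp

/-- The key step: a minimal presentation `K → F₁ → W → 0` with `W ⊗ IN → F₀ ⊗ IN` and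
`K ⊗ IN → F₁ ⊗ IN` injective forces `K ⊗ IN = I (K ⊗ IN)`. -/
theorem tensorProduct_smul_top_le_of_injective
    {R K F₁ W F₀ N : Type*} [CommRing R]
    [AddCommGroup K] [Module R K] [AddCommGroup F₁] [Module R F₁] [AddCommGroup W] [Module R W]
    [AddCommGroup F₀] [Module R F₀] [AddCommGroup N] [Module R N] [Module.Flat R F₀]
    (I : Ideal R)
    {g : K →ₗ[R] F₁} {p : F₁ →ₗ[R] W} {h : W →ₗ[R] F₀}
    (hgp : Function.Exact g p) (hp : Function.Surjective p)
    (hmin : ∀ w, g w ∈ I • (⊤ : Submodule R F₁))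
    (hh : Function.Injective (h.rTensor ↥(I • (⊤ : Submodule R N))))
    (hg : Function.Injective (g.rTensor ↥(I • (⊤ : Submodule R N)))) :
    (⊤ : Submodule R (K ⊗[R] ↥(I • (⊤ : Submodule R N)))) ≤ I • ⊤ := by
  let L := I • (⊤ : Submodule R N)
  have hg' : Function.Injective (g.rTensor L) := hg
  let μ (a : I) : N →ₗ[R] L := (LinearMap.lsmul R N a.1).codRestrict L
    fun n ↦ Submodule.smul_mem_smul a.2 trivial
  have hμ (a : I) : μ a ∘ₗ L.subtype = LinearMap.lsmul R L a.1 := by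
    ext; rfl
  have hrange (x : K ⊗[R] N) : g.rTensor N x ∈ LinearMap.range (L.subtype.lTensor F₁) := by
    induction x with
    | zero => simp
    | add x y hx hy => rw [map_add]; exact add_mem hx hy
    | tmul w n =>
      rw [LinearMap.rTensor_tmul]
      refine Submodule.smul_induction_on (p := fun f ↦ f ⊗ₜ[R] n ∈ _) (hmin w) ?_ ?_
      · intro a ha f _
        exact ⟨f ⊗ₜ μ ⟨a, ha⟩ n, (TensorProduct.smul_tmul a f n).symm⟩
      · intro x y hx hy
        rw [TensorProduct.add_tmul]
        exact add_mem hx hy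
  have key (x : K ⊗[R] N) (a : I) : (μ a).lTensor K x ∈ I • (⊤ : Submodule R (K ⊗[R] L)) := by
    obtain ⟨u, hu⟩ := hrange x
    have hpu : p.rTensor L u = 0 := by
      apply hh
      apply Module.Flat.lTensor_preserves_injective_linearMap (M := F₀) L.subtype
        L.subtype_injective
      rw [LinearMap.lTensor_rTensor_apply, LinearMap.lTensor_rTensor_apply, hu, (rTensor_exact N hgp hp).apply_apply_eq_zero]
      simp
    obtain ⟨y, rfl⟩ := (rTensor_exact L hgp hp _).1 hpu
    have : (μ a).lTensor K x = a.1 • y := by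
      apply hg'
      rw [← LinearMap.lTensor_rTensor_apply, ← hu, ← LinearMap.comp_apply, ← LinearMap.lTensor_comp, hμ, LinearMap.lTensor_rTensor_apply]
      congr 1
      clear hu hpu
      induction y with
      | zero => simp
      | add x y hx hy => rw [map_add, hx, hy, smul_add]
      | tmul w n => simp
    rw [this]
    exact Submodule.smul_mem_smul a.2 trivial
  rintro x -
  induction x with
  | zero => exact zero_mem _
  | add x y hx hy => exact add_mem hx hy
  | tmul w l =>
    obtain ⟨l, hl⟩ := l
    induction hl using Submodule.smul_induction_on' with
    | smul a ha n hn => exact key (w ⊗ₜ n) ⟨a, ha⟩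
    | add x hx y hy ihx ihy =>
      exact (TensorProduct.tmul_add (R := R) w (⟨x, hx⟩ : L) ⟨y, hy⟩).symm ▸ add_mem ihx ihy

theorem IsLocalRing.subsingleton_or_subsingleton_of_rTensor_injective
    {R K F₁ W F₀ N : Type*} [CommRing R] [IsNoetherianRing R] [IsLocalRing R]
    [AddCommGroup K] [Module R K] [AddCommGroup F₁] [Module R F₁] [AddCommGroup W] [Module R W]
    [AddCommGroup F₀] [Module R F₀] [AddCommGroup N] [Module R N] [Module.Flat R F₀]
    [Module.Finite R K] [Module.Finite R N]
    {g : K →ₗ[R] F₁} {p : F₁ →ₗ[R] W} {h : W →ₗ[R] F₀}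
    (hgp : Function.Exact g p) (hp : Function.Surjective p)
    (hmin : ∀ w, g w ∈ maximalIdeal R • (⊤ : Submodule R F₁))
    (hh : Function.Injective (h.rTensor ↥(maximalIdeal R • (⊤ : Submodule R N))))
    (hg : Function.Injective (g.rTensor ↥(maximalIdeal R • (⊤ : Submodule R N)))) :
    Subsingleton K ∨ Subsingleton ↥(maximalIdeal R • (⊤ : Submodule R N)) :=
  subsingleton_or_subsingleton_of_tensorProduct <| subsingleton_of_top_le_smul_top <|
    tensorProduct_smul_top_le_of_injective _ hgp hp hmin hh hg

open ModuleCat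

theorem CategoryTheory.ProjectiveResolution.exact_lTensor_of_torIsZero
    {R : Type u} [CommRing R] {M L : Type u} [AddCommGroup M] [Module R M]
    [AddCommGroup L] [Module R L] (P : ProjectiveResolution (ModuleCat.of R L)) {n : ℕ}
    (h : TorIsZero R M L (n + 1)) :
    Function.Exact ((P.complex.d (n + 2) (n + 1)).hom.lTensor M)
      ((P.complex.d (n + 1) n).hom.lTensor M) := by
  let F := (MonoidalCategory.tensoringLeft (ModuleCat.{u} R)).obj (ModuleCat.of R M)
  have hz : Limits.IsZero (((F.mapHomologicalComplex _).obj P.complex).homology (n + 1)) :=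
    (@ModuleCat.isZero_of_subsingleton _ _ _ h).of_iso (P.isoLeftDerivedObj F (n + 1)).symm
  rw [← HomologicalComplex.exactAt_iff_isZero_homology,
    HomologicalComplex.exactAt_iff' _ (n + 2) (n + 1) n (by simp) (by simp),
    ShortComplex.ShortExact.moduleCat_exact_iff_function_exact] at hz
  exact hz

theorem TorIsZero.subsingleton_tensorProduct
    {R : Type u} [CommRing R] {M L : Type u} [AddCommGroup M] [Module R M]
    [AddCommGroup L] [Module R L] (h : TorIsZero R M L 0) : Subsingleton (M ⊗[R] L) := by
  let F := (MonoidalCategory.tensoringLeft (ModuleCat.{u} R)).obj (ModuleCat.of R M)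
  have : Limits.PreservesFiniteColimits F :=
    inferInstanceAs (Limits.PreservesFiniteColimits
      (MonoidalCategory.tensorLeft (ModuleCat.of R M)))
  have hz : Limits.IsZero (F.obj (ModuleCat.of R L)) :=
    (@ModuleCat.isZero_of_subsingleton _ _ _ h).of_iso (F.leftDerivedZeroIsoSelf.app _).symm
  exact ModuleCat.subsingleton_of_isZero hz

section

variable {R : Type u} [CommRing R] {K F M L : Type u} [AddCommGroup K] [Module R K]
  [AddCommGroup F] [Module R F] [AddCommGroup M] [Module R M] [AddCommGroup L] [Module R L]

theorem CategoryTheory.ProjectiveResolution.flat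
    (P : ProjectiveResolution (ModuleCat.of R L)) (n : ℕ) : Module.Flat R (P.complex.X n) :=
  have : Module.Projective R (P.complex.X n) :=
    (IsProjective.iff_projective (P.complex.X n)).2 (P.projective n)
  inferInstance

theorem CategoryTheory.ProjectiveResolution.exact_hom
    (P : ProjectiveResolution (ModuleCat.of R L)) (n : ℕ) :
    Function.Exact (P.complex.d (n + 2) (n + 1)).hom (P.complex.d (n + 1) n).hom :=
  (ShortComplex.ShortExact.moduleCat_exact_iff_function_exact _).1 (P.exact_succ n)

theorem TorIsZero.of_exact [Module.Flat R F] {i : K →ₗ[R] F} {p : F →ₗ[R] M}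
    (hi : Function.Injective i) (hip : Function.Exact i p) (hp : Function.Surjective p) {n : ℕ}
    (h : TorIsZero R M L (n + 2)) : TorIsZero R K L (n + 1) := by
  let P := projectiveResolution (ModuleCat.of R L)
  have := P.flat (n + 1)
  let G := (MonoidalCategory.tensoringLeft (ModuleCat.{u} R)).obj (ModuleCat.of R K)
  have hz : Limits.IsZero (((G.mapHomologicalComplex _).obj P.complex).homology (n + 1)) := by
    rw [← HomologicalComplex.exactAt_iff_isZero_homology,
      HomologicalComplex.exactAt_iff' _ (n + 2) (n + 1) n (by simp) (by simp),
      ShortComplex.ShortExact.moduleCat_exact_iff_function_exact]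
    have key : Function.Exact ((P.complex.d (n + 2) (n + 1)).hom.lTensor K)
        ((P.complex.d (n + 1) n).hom.lTensor K) := by
      intro x
      refine ⟨fun hx ↦ exists_lTensor_eq_of_exact hi hip hp
        (LinearMap.ext (P.exact_hom (n + 1)).apply_apply_eq_zero)
        (Module.Flat.lTensor_exact F (P.exact_hom n)) (P.exact_lTensor_of_torIsZero h) x ?_, ?_⟩
      · rw [LinearMap.lTensor_rTensor_apply, hx, map_zero]
      · rintro ⟨y, rfl⟩
        rw [← LinearMap.comp_apply, ← LinearMap.lTensor_comp,
          (P.exact_hom n).linearMap_comp_eq_zero]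
        simp
    exact key
  exact ModuleCat.subsingleton_of_isZero (hz.of_iso (P.isoLeftDerivedObj G (n + 1)))

theorem TorIsZero.rTensor_injective [Module.Flat R F] {i : K →ₗ[R] F} {p : F →ₗ[R] M}
    (hi : Function.Injective i) (hip : Function.Exact i p) (hp : Function.Surjective p)
    (h : TorIsZero R M L 1) : Function.Injective (i.rTensor L) := by
  let P := projectiveResolution (ModuleCat.of R L)
  have := P.flat 0
  let π : P.complex.X 0 →ₗ[R] L := (P.π.f 0).hom
  have hπ : Function.Surjective π :=
    (ModuleCat.epi_iff_surjective (P.π.f 0)).1 inferInstance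
  have hdπ : Function.Exact (P.complex.d 1 0).hom π :=
    (ShortComplex.ShortExact.moduleCat_exact_iff_function_exact _).1 P.exact₀
  rw [injective_iff_map_eq_zero]
  intro x hx
  obtain ⟨x, rfl⟩ := π.lTensor_surjective K hπ x
  obtain ⟨y, rfl⟩ := exists_lTensor_eq_of_exact hi hip hp
    (LinearMap.ext (P.exact_hom 0).apply_apply_eq_zero)
    (Module.Flat.lTensor_exact F hdπ) (P.exact_lTensor_of_torIsZero h) x
    (by rw [LinearMap.lTensor_rTensor_apply, hx])
  rw [← LinearMap.comp_apply, ← LinearMap.lTensor_comp, hdπ.linearMap_comp_eq_zero]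
  simp

theorem HasProjDimLT.of_projective [Module.Projective R M] : HasProjDimLT R M 1 := by
  have : Projective (ModuleCat.of R M) := (IsProjective.iff_projective _).1 inferInstance
  refine ⟨ProjectiveResolution.self _, fun i hi ↦ ?_⟩
  exact HomologicalComplex.isZero_single_obj_X _ _ _ _ (by lia)

theorem HasProjDimLT.of_exact [Module.Projective R F] {i : K →ₗ[R] F} {p : F →ₗ[R] M}
    (hi : Function.Injective i) (hip : Function.Exact i p) (hp : Function.Surjective p) {n : ℕ}
    (h : HasProjDimLT R K n) : HasProjDimLT R M (n + 1) := by
  obtain ⟨P, hP⟩ := h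
  have : Projective (ModuleCat.of R F) := (IsProjective.iff_projective _).1 inferInstance
  let π : P.complex.X 0 →ₗ[R] K := (P.π.f 0).hom
  have hπ : Function.Surjective π :=
    (ModuleCat.epi_iff_surjective (P.π.f 0)).1 inferInstance
  have hdπ : Function.Exact (P.complex.d 1 0).hom π :=
    (ShortComplex.ShortExact.moduleCat_exact_iff_function_exact _).1 P.exact₀
  let f : P.complex.X 0 ⟶ ModuleCat.of R F := ModuleCat.ofHom (i ∘ₗ π)
  have hdf : Function.Exact (P.complex.d 1 0).hom f.hom := hdπ.comp_injective i hi (map_zero i)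
  have hfp : Function.Exact f.hom p := by
    intro x
    rw [hip x]
    exact ⟨fun ⟨k, hk⟩ ↦ (hπ k).imp fun y hy ↦ (congrArg i hy).trans hk, fun ⟨y, hy⟩ ↦ ⟨π y, hy⟩⟩
  let Q := P.complex.augment f (ModuleCat.hom_ext hdf.linearMap_comp_eq_zero)
  have hQp : Q.d 1 0 ≫ ModuleCat.ofHom p = 0 := ModuleCat.hom_ext hfp.linearMap_comp_eq_zero
  have hQ (k : ℕ) : Q.ExactAt (k + 1) := by
    rw [HomologicalComplex.exactAt_iff' _ (k + 2) (k + 1) k (by simp) (by simp),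
      ShortComplex.ShortExact.moduleCat_exact_iff_function_exact]
    cases k with
    | zero => exact hdf
    | succ k => exact P.exact_hom k
  refine ⟨{ complex := Q
            projective := fun k ↦ ?_
            π := (ChainComplex.toSingle₀Equiv _ _).symm ⟨ModuleCat.ofHom p, hQp⟩
            quasiIso := ⟨fun k ↦ ?_⟩ }, fun k hk ↦ ?_⟩
  · cases k with
    | zero => exact this
    | succ k => exact P.projective k
  · cases k with
    | zero =>
      rw [ChainComplex.quasiIsoAt₀_iff, ShortComplex.quasiIso_iff_of_zeros' _ rfl rfl rfl]
      refine (ShortComplex.exact_and_epi_g_iff_of_iso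
        (S₂ := ShortComplex.mk (Q.d 1 0) (ModuleCat.ofHom p) hQp) ?_).2 ⟨?_, ?_⟩
      · exact ShortComplex.isoMk (Iso.refl _) (Iso.refl _) (Iso.refl _)
          ((Category.id_comp _).trans (Category.comp_id _).symm)
          ((Category.id_comp _).trans
            ((ChainComplex.toSingle₀Equiv_symm_apply_f_zero _ hQp).symm.trans
              (Category.comp_id _).symm))
      · exact (ShortComplex.ShortExact.moduleCat_exact_iff_function_exact _).2 hfp
      · exact (ModuleCat.epi_iff_surjective _).2 hp
    | succ k =>
      rw [quasiIsoAt_iff_exactAt']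
      · exact hQ k
      · exact ChainComplex.exactAt_succ_single_obj _ _
  · cases k with
    | zero => lia
    | succ k => exact hP k (by lia)

end

/-- Over a Noetherian local ring `(R, 𝔪)`, if `M`, `N` are finitely generated,
`t ≥ 0` and `Tor_t^R(M, 𝔪N) = Tor_{t+1}^R(M, 𝔪N) = 0`, then either `pd_R M ≤ t` or `𝔪N = 0`. -/
theorem two_consecutive_tor_vanishing_mN
    {R : Type u} [CommRing R] [IsNoetherianRing R] [IsLocalRing R]
    {M : Type u} [AddCommGroup M] [Module R M] [Module.Finite R M]
    {N : Type u} [AddCommGroup N] [Module R N] [Module.Finite R N]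
    (t : ℕ)
    (h1 : TorIsZero R M (↥(IsLocalRing.maximalIdeal R • (⊤ : Submodule R N))) t)
    (h2 : TorIsZero R M (↥(IsLocalRing.maximalIdeal R • (⊤ : Submodule R N))) (t + 1)) :
    HasProjDimLT R M (t + 1) ∨ IsLocalRing.maximalIdeal R • (⊤ : Submodule R N) = ⊥ := by
  rw [← Submodule.subsingleton_iff_eq_bot]
  induction t generalizing M with
  | zero =>
    refine (IsLocalRing.subsingleton_or_subsingleton_of_tensorProduct
      h1.subsingleton_tensorProduct).imp_left fun (_ : Subsingleton M) ↦ ?_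
    have := Module.Free.of_subsingleton R M
    exact HasProjDimLT.of_projective
  | succ t ih =>
    obtain ⟨n₀, p₀, hp₀, -⟩ := IsLocalRing.exists_surjective_ker_le_smul_top (R := R) M
    have hi₀ := (LinearMap.ker p₀).subtype_injective
    have hip₀ := p₀.exact_subtype_ker_map
    suffices h : HasProjDimLT R (LinearMap.ker p₀) (t + 1) ∨
        Subsingleton ↥(IsLocalRing.maximalIdeal R • (⊤ : Submodule R N)) from
      h.imp_left (HasProjDimLT.of_exact hi₀ hip₀ hp₀)
    have h2' := h2.of_exact hi₀ hip₀ hp₀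
    cases t with
    | succ t => exact ih (h1.of_exact hi₀ hip₀ hp₀) h2'
    | zero =>
      obtain ⟨n₁, p₁, hp₁, hmin⟩ :=
        IsLocalRing.exists_surjective_ker_le_smul_top (R := R) (LinearMap.ker p₀)
      have hi₁ := (LinearMap.ker p₁).subtype_injective
      have hip₁ := p₁.exact_subtype_ker_map
      refine (IsLocalRing.subsingleton_or_subsingleton_of_rTensor_injective hip₁ hp₁
        (fun w ↦ hmin w.2) (h1.rTensor_injective hi₀ hip₀ hp₀)
        (h2'.rTensor_injective hi₁ hip₁ hp₁)).imp_left fun hK ↦ ?_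
      have hinj : Function.Injective p₁ :=
        LinearMap.ker_eq_bot.1 (Submodule.subsingleton_iff_eq_bot.1 hK)
      have := Module.Projective.of_equiv (LinearEquiv.ofBijective p₁ ⟨hinj, hp₁⟩)
      exact HasProjDimLT.of_projective
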